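/- arXiv:1503.01695 — 4 statements merged into one kernel-verified Lean document; each statement's English description precedes it below -/
import Mathlib

section
/- Let n ≥ 1, 0 < μ < n/2, and let u be a Schwartz function on ℝⁿ. Then the double integral ∫_{ℝⁿ}∫_{ℝⁿ} |x−y|^{2μ−n} u(x) conj(u(y)) dx dy converges absolutely and (2^{−2μ} Γ(n/2−μ))/(π^{n/2} Γ(μ)) · ∫_{ℝⁿ}∫_{ℝⁿ} |x−y|^{2μ−n} u(x) conj(u(y)) dx dy = ∫_{ℝⁿ} |𝓕u(ξ)|² |ξ|^{−2μ} dξ. -/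
open MeasureTheory
open Complex (I)

/-- The Fourier transform `𝓕u(ξ) = (2π)^{-n/2} ∫ e^{-i x·ξ} u(x) dx` on `ℝⁿ`. -/
noncomputable def ftn (n : ℕ) (u : (Fin n → ℝ) → ℂ) (ξ : Fin n → ℝ) : ℂ :=
  (((2 * Real.pi) ^ (-((n : ℝ) / 2)) : ℝ) : ℂ) *
    ∫ x : Fin n → ℝ, Complex.exp (-I * ((∑ j, x j * ξ j : ℝ) : ℂ)) * u x


lemma aux_gauss (n : ℕ) {t : ℝ} (ht : 0 < t) (w : Fin n → ℝ) :
    ∫ ξ : Fin n → ℝ, Complex.exp (-I * ((∑ j, w j * ξ j : ℝ) : ℂ)) *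
        ((Real.exp (-(t * ∑ j, ξ j ^ 2)) : ℝ) : ℂ)
      = (((Real.pi / t) ^ ((n : ℝ) / 2) * Real.exp (-((∑ j, w j ^ 2) / 4 / t)) : ℝ) : ℂ) := by
  have h := GaussianFourier.integral_cexp_neg_mul_sum_add (ι := Fin n) (b := (t : ℂ))
    (by simpa using ht) (fun j => -I * w j)
  have e1 : (fun ξ : Fin n → ℝ => Complex.exp (-I * ((∑ j, w j * ξ j : ℝ) : ℂ)) *
        ((Real.exp (-(t * ∑ j, ξ j ^ 2)) : ℝ) : ℂ)) = fun v : Fin n → ℝ =>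
        Complex.exp (-(t : ℂ) * ∑ i, (v i : ℂ) ^ 2 + ∑ i, (-I * w i) * v i) := by
    funext ξ
    push_cast
    rw [← Complex.exp_add]
    congr 1
    rw [Finset.mul_sum]
    simp only [mul_assoc]
    ring
  rw [e1, h]
  push_cast
  rw [Complex.ofReal_cpow (by positivity)]
  push_cast
  simp only [Fintype.card_fin]
  congr 2
  simp only [mul_pow, neg_sq, Complex.I_sq, neg_mul, one_mul, Finset.sum_neg_distrib]
  have : (t : ℂ) ≠ 0 := by exact_mod_cast ht.ne'
  field_simp

lemma aux_gauss_int (n : ℕ) {t : ℝ} (ht : 0 < t) :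
    Integrable (fun ξ : Fin n → ℝ => ((Real.exp (-(t * ∑ j, ξ j ^ 2)) : ℝ) : ℂ)) := by
  have h := GaussianFourier.integrable_cexp_neg_mul_sum_add (ι := Fin n) (b := (t : ℂ))
    (by simpa using ht) (fun j => 0)
  refine h.congr (Filter.Eventually.of_forall fun ξ => ?_)
  simp

lemma aux_gamma1 {a r : ℝ} (ha : 0 < a) (hr : 0 < r) :
    ∫ t in Set.Ioi (0:ℝ), t ^ (a - 1) * Real.exp (-(t * r)) = r ^ (-a) * Real.Gamma a := by
  have := Real.integral_rpow_mul_exp_neg_mul_Ioi ha hr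
  simp only [mul_comm r] at this
  rw [this, one_div, Real.inv_rpow hr.le, Real.rpow_neg hr.le]

lemma aux_gamma2 {a r : ℝ} (ha : 0 < a) (hr : 0 < r) :
    ∫ t in Set.Ioi (0:ℝ), t ^ (-a - 1) * Real.exp (-(r / t)) = r ^ (-a) * Real.Gamma a := by
  rw [← aux_gamma1 ha hr, ← integral_comp_rpow_Ioi _ (p := -1) (by norm_num)]
  refine setIntegral_congr_fun measurableSet_Ioi fun t ht => ?_
  have ht : 0 < t := ht
  simp only [abs_neg, abs_one, one_mul, smul_eq_mul]
  rw [← mul_assoc, ← Real.rpow_mul ht.le, ← Real.rpow_add ht, Real.rpow_neg_one]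
  congr 2
  · ring
  · field_simp

lemma aux_gamma2_int {a r : ℝ} (ha : 0 < a) (hr : 0 < r) :
    IntegrableOn (fun t : ℝ => t ^ (-a - 1) * Real.exp (-(r / t))) (Set.Ioi (0:ℝ)) := by
  apply Integrable.of_integral_ne_zero
  rw [aux_gamma2 ha hr]
  have := Real.Gamma_pos_of_pos ha
  positivity

lemma aux_kernel_le (n : ℕ) (hn : 1 ≤ n) {a : ℝ} (ha : 0 < a) (z : Fin n → ℝ) :
    (∑ j, z j ^ 2) ^ (-a) ≤ ‖z‖ ^ (-(2 * a)) := by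
  rcases eq_or_ne z 0 with rfl | hz
  · simp [ha.ne']
  have h0 : 0 < ‖z‖ := norm_pos_iff.2 hz
  have : ‖z‖ ^ 2 ≤ ∑ j, z j ^ 2 := by
    have : Nonempty (Fin n) := ⟨⟨0, hn⟩⟩
    obtain ⟨i, hi⟩ := Finite.exists_max (fun j => ‖z j‖)
    have : ‖z‖ ≤ ‖z i‖ := (pi_norm_le_iff_of_nonneg (norm_nonneg _)).2 hi
    calc ‖z‖ ^ 2 ≤ ‖z i‖ ^ 2 := by gcongr
      _ = z i ^ 2 := by simp
      _ ≤ _ := Finset.single_le_sum (f := fun j => z j ^ 2) (fun j _ => sq_nonneg _) (Finset.mem_univ i)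
  calc _ ≤ (‖z‖ ^ 2) ^ (-a) := Real.rpow_le_rpow_of_nonpos (by positivity) this (by linarith)
    _ = _ := by
      rw [← Real.rpow_natCast, ← Real.rpow_mul h0.le]; congr 1; push_cast; ring

lemma aux_loc (n : ℕ) (hn : 1 ≤ n) {a : ℝ} (ha2 : 2 * a < n) :
    Integrable (fun z : Fin n → ℝ => (Set.Iio (1:ℝ)).indicator (fun r => r ^ (-(2*a))) ‖z‖) := by
  have : Nonempty (Fin n) := ⟨⟨0, hn⟩⟩
  rw [integrable_fun_norm_addHaar (μ := (volume : Measure (Fin n → ℝ)))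
    (f := (Set.Iio (1:ℝ)).indicator (fun r => r ^ (-(2*a))))]
  have h : IntegrableOn (fun r : ℝ => r ^ ((n:ℝ) - 1 - 2 * a)) (Set.Ioo 0 1) :=
    (intervalIntegral.integrableOn_Ioo_rpow_iff one_pos).2 (by linarith)
  rw [← integrable_indicator_iff measurableSet_Ioi]
  rw [← integrable_indicator_iff measurableSet_Ioo] at h
  refine h.congr (Filter.Eventually.of_forall fun r => ?_)
  by_cases h0 : 0 < r <;> by_cases h1 : r < 1 <;> simp [Set.indicator, h0, h1]
  rw [← Real.rpow_natCast, ← Real.rpow_add h0, Nat.cast_sub hn]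
  congr 1; push_cast; ring

lemma aux_k_bound (n : ℕ) (hn : 1 ≤ n) {a : ℝ} (ha : 0 < a) (z : Fin n → ℝ) :
    (∑ j, z j ^ 2) ^ (-a) ≤ (Set.Iio (1:ℝ)).indicator (fun r => r ^ (-(2*a))) ‖z‖ + 1 := by
  have h := aux_kernel_le n hn ha z
  by_cases h1 : ‖z‖ < 1
  · simp only [Set.indicator, Set.mem_Iio, h1, if_true]; linarith
  · simp only [Set.indicator, Set.mem_Iio, h1, if_false]
    have := Real.rpow_le_one_of_one_le_of_nonpos (not_lt.1 h1) (z := -(2*a)) (by linarith)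
    linarith

lemma aux_kint (n : ℕ) (hn : 1 ≤ n) {a : ℝ} (ha : 0 < a) (ha2 : 2 * a < n)
    (u : SchwartzMap (Fin n → ℝ) ℂ) :
    Integrable (fun p : (Fin n → ℝ) × (Fin n → ℝ) =>
        (((∑ j, (p.1 j - p.2 j) ^ 2) ^ (-a) : ℝ) : ℂ) *
          (u p.1 * (starRingEnd ℂ) (u p.2))) (volume.prod volume) := by
  have hu : Integrable (fun x => ‖u x‖) := u.integrable.norm
  obtain ⟨C, hC0, hC⟩ := u.decay 0 0
  have hC' : ∀ x, ‖u x‖ ≤ C := by simpa using hC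
  have hc : Continuous fun x => ‖u x‖ := u.continuous.norm
  have h1 := Integrable.convolution_integrand (ContinuousLinearMap.mul ℝ ℝ) hu (aux_loc n hn ha2)
  have h2 := h1.bdd_mul (f := fun p : (Fin n → ℝ) × (Fin n → ℝ) => ‖u p.1‖) (c := C)
    (hc.comp continuous_fst).aestronglyMeasurable
    (Filter.Eventually.of_forall fun p => by simpa using hC' p.1)
  have h3 := h2.add (hu.mul_prod hu)
  refine h3.mono' ?_ (Filter.Eventually.of_forall fun p => ?_)
  · have m1 : Measurable fun p : (Fin n → ℝ) × (Fin n → ℝ) =>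
        (((∑ j, (p.1 j - p.2 j) ^ 2) ^ (-a) : ℝ) : ℂ) := by fun_prop
    have m2 : Continuous fun p : (Fin n → ℝ) × (Fin n → ℝ) => 
      (u p.1 * (starRingEnd ℂ) (u p.2)) :=
      (u.continuous.comp continuous_fst).mul
        (Complex.continuous_conj.comp (u.continuous.comp continuous_snd))
    exact (m1.mul m2.measurable).aestronglyMeasurable
  · have := aux_k_bound n hn ha (p.1 - p.2)
    simp only [Pi.sub_apply] at this
    have h0 : 0 ≤ (∑ j, (p.1 j - p.2 j) ^ 2) ^ (-a) :=
      Real.rpow_nonneg (Finset.sum_nonneg fun j _ => sq_nonneg _) _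
    simp only [norm_mul, Complex.norm_real, Real.norm_eq_abs, abs_of_nonneg h0, RCLike.norm_conj,
      Pi.add_apply, ContinuousLinearMap.mul_apply']
    have := mul_le_mul_of_nonneg_right this (mul_nonneg (norm_nonneg (u p.1)) (norm_nonneg (u p.2)))
    refine this.trans (le_of_eq ?_)
    ring

lemma aux_ftn_sm (n : ℕ) (u : SchwartzMap (Fin n → ℝ) ℂ) : StronglyMeasurable (ftn n u) := by
  unfold ftn
  apply StronglyMeasurable.const_mul
  have hc : Continuous fun p : (Fin n → ℝ) × (Fin n → ℝ) =>
      Complex.exp (-I * ((∑ j, p.2 j * p.1 j : ℝ) : ℂ)) * u p.2 := by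
    have := u.continuous
    fun_prop
  exact hc.stronglyMeasurable.integral_prod_right'

lemma aux_norm_exp (s : ℝ) : ‖Complex.exp (-I * (s : ℂ))‖ = 1 := by
  rw [Complex.norm_exp]; simp

lemma aux_ftn_bdd (n : ℕ) (u : SchwartzMap (Fin n → ℝ) ℂ) : ∃ C, ∀ ξ, ‖ftn n u ξ‖ ≤ C := by
  refine ⟨((2 * Real.pi) ^ (-((n : ℝ) / 2))) * ∫ x, ‖u x‖, fun ξ => ?_⟩
  unfold ftn
  rw [norm_mul, Complex.norm_real, Real.norm_of_nonneg (by positivity)]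
  gcongr
  refine (norm_integral_le_integral_norm _).trans (le_of_eq ?_)
  congr 1; funext x
  rw [norm_mul, aux_norm_exp, one_mul]

lemma aux_ftn_sq (n : ℕ) (u : SchwartzMap (Fin n → ℝ) ℂ) (ξ : Fin n → ℝ) :
    ((‖ftn n u ξ‖ ^ 2 : ℝ) : ℂ) = (((2 * Real.pi) ^ (-(n : ℝ)) : ℝ) : ℂ) *
      ∫ p : (Fin n → ℝ) × (Fin n → ℝ), Complex.exp (-I * ((∑ j, (p.1 j - p.2 j) * ξ j : ℝ) : ℂ)) *
        (u p.1 * (starRingEnd ℂ) (u p.2)) ∂(volume.prod volume) := by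
  push_cast
  rw [← Complex.mul_conj']
  unfold ftn
  rw [map_mul, ← integral_conj, mul_mul_mul_comm, ← integral_prod_mul, Complex.conj_ofReal,
    ← Complex.ofReal_mul, ← Real.rpow_add (by positivity)]
  congr 1
  · congr 2; ring
  · congr 1; funext p
    simp only [map_mul, ← Complex.exp_conj, map_neg, Complex.conj_I, Complex.conj_ofReal, neg_neg]
    rw [mul_mul_mul_comm, ← Complex.exp_add]
    congr 2
    simp only [sub_mul, Finset.sum_sub_distrib]
    push_cast; ring

lemma aux_heat (n : ℕ) (u : SchwartzMap (Fin n → ℝ) ℂ) {t : ℝ} (ht : 0 < t) :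
    ((∫ ξ, ‖ftn n u ξ‖ ^ 2 * Real.exp (-(t * ∑ j, ξ j ^ 2)) : ℝ) : ℂ) =
      (((2 * Real.pi) ^ (-(n : ℝ)) * (Real.pi / t) ^ ((n : ℝ) / 2) : ℝ) : ℂ) *
      ∫ p : (Fin n → ℝ) × (Fin n → ℝ),
        ((Real.exp (-((∑ j, (p.1 j - p.2 j) ^ 2) / 4 / t)) : ℝ) : ℂ) *
        (u p.1 * (starRingEnd ℂ) (u p.2)) ∂(volume.prod volume) := by
  have hI : Integrable (Function.uncurry fun (ξ : Fin n → ℝ) (p : (Fin n → ℝ) × (Fin n → ℝ)) =>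
      Complex.exp (-I * ((∑ j, (p.1 j - p.2 j) * ξ j : ℝ) : ℂ)) *
        (((Real.exp (-(t * ∑ j, ξ j ^ 2)) : ℝ) : ℂ) * (u p.1 * (starRingEnd ℂ) (u p.2))))
      (volume.prod (volume.prod volume)) := by
    have h1 : Integrable (fun x => (starRingEnd ℂ) (u x)) :=
      (Complex.conjLIE.integrable_comp_iff (φ := u)).2 (u.integrable (μ := volume))
    have h2 := (aux_gauss_int n ht).mul_prod ((u.integrable (μ := volume)).mul_prod h1)
    refine h2.bdd_mul (c := 1) ?_ (Filter.Eventually.of_forall fun p => ?_)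
    · exact Continuous.aestronglyMeasurable (by fun_prop)
    · exact (aux_norm_exp _).le
  rw [← integral_complex_ofReal]
  have e1 : ∀ ξ : Fin n → ℝ, ((‖ftn n u ξ‖ ^ 2 * Real.exp (-(t * ∑ j, ξ j ^ 2)) : ℝ) : ℂ) =
      (((2 * Real.pi) ^ (-(n : ℝ)) : ℝ) : ℂ) * ∫ p : (Fin n → ℝ) × (Fin n → ℝ),
      Complex.exp (-I * ((∑ j, (p.1 j - p.2 j) * ξ j : ℝ) : ℂ)) *
        (((Real.exp (-(t * ∑ j, ξ j ^ 2)) : ℝ) : ℂ) * (u p.1 * (starRingEnd ℂ) (u p.2)))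
        ∂(volume.prod volume) := by
    intro ξ
    rw [Complex.ofReal_mul, aux_ftn_sq, mul_assoc, ← integral_mul_const]
    congr 2; funext p; ring
  refine (integral_congr_ae (Filter.Eventually.of_forall e1)).trans ?_
  rw [integral_const_mul, integral_integral_swap hI, Complex.ofReal_mul, mul_assoc]
  congr 1
  rw [← integral_const_mul]
  congr 1; funext p
  have := aux_gauss n ht (p.1 - p.2)
  simp only [Pi.sub_apply] at this
  simp only [← mul_assoc]
  rw [integral_mul_const, integral_mul_const, this]
  push_cast; rfl

lemma aux_diag (n : ℕ) (hn : 1 ≤ n) :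
    ∀ᵐ p : (Fin n → ℝ) × (Fin n → ℝ) ∂(volume.prod volume), 0 < ∑ j, (p.1 j - p.2 j) ^ 2 := by
  have : Nonempty (Fin n) := ⟨⟨0, hn⟩⟩
  have hm : MeasurableSet {p : (Fin n → ℝ) × (Fin n → ℝ) | 0 < ∑ j, (p.1 j - p.2 j) ^ 2} :=
    measurableSet_lt measurable_const (by fun_prop)
  rw [Measure.ae_prod_iff_ae_ae hm]
  refine Filter.Eventually.of_forall fun x => ?_
  filter_upwards [Measure.ae_ne volume x] with y hy
  have h0 : 0 ≤ ∑ j, (x j - y j) ^ 2 := Finset.sum_nonneg fun j _ => sq_nonneg _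
  refine lt_of_le_of_ne h0 fun h => hy ?_
  rw [eq_comm, Finset.sum_eq_zero_iff_of_nonneg fun j _ => sq_nonneg _] at h
  funext j
  have := h j (Finset.mem_univ j)
  have := pow_eq_zero_iff (two_ne_zero) |>.1 this
  linarith

lemma aux_ne (n : ℕ) (hn : 1 ≤ n) :
    ∀ᵐ x : Fin n → ℝ, 0 < ∑ j, x j ^ 2 := by
  have : Nonempty (Fin n) := ⟨⟨0, hn⟩⟩
  filter_upwards [Measure.ae_ne volume (0 : Fin n → ℝ)] with y hy
  have h0 : 0 ≤ ∑ j, (y j) ^ 2 := Finset.sum_nonneg fun j _ => sq_nonneg _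
  refine lt_of_le_of_ne h0 fun h => hy ?_
  rw [eq_comm, Finset.sum_eq_zero_iff_of_nonneg fun j _ => sq_nonneg _] at h
  funext j
  exact pow_eq_zero_iff (two_ne_zero) |>.1 (h j (Finset.mem_univ j))

/-- The spatial side. -/
lemma aux_A (n : ℕ) (hn : 1 ≤ n) {a : ℝ} (ha : 0 < a) (ha2 : 2 * a < n)
    (u : SchwartzMap (Fin n → ℝ) ℂ) :
    Integrable (Function.uncurry fun (p : (Fin n → ℝ) × (Fin n → ℝ)) (t : ℝ) =>
      ((t ^ (-a - 1) * Real.exp (-((∑ j, (p.1 j - p.2 j) ^ 2) / 4 / t)) : ℝ) : ℂ) *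
        (u p.1 * (starRingEnd ℂ) (u p.2)))
      ((volume.prod volume).prod (volume.restrict (Set.Ioi (0:ℝ)))) := by
  have m2 : Continuous fun p : (Fin n → ℝ) × (Fin n → ℝ) =>
      (u p.1 * (starRingEnd ℂ) (u p.2)) :=
      (u.continuous.comp continuous_fst).mul
        (Complex.continuous_conj.comp (u.continuous.comp continuous_snd))
  rw [integrable_prod_iff]
  · constructor
    · filter_upwards [aux_diag n hn] with p hp
      have h := aux_gamma2_int ha (r := (∑ j, (p.1 j - p.2 j) ^ 2) / 4) (by positivity)
      exact (Integrable.ofReal (𝕜 := ℂ) h).mul_const (u p.1 * (starRingEnd ℂ) (u p.2))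
    · have h := ((aux_kint n hn ha ha2 u).norm).const_mul (Real.Gamma a * (1/4:ℝ) ^ (-a))
      refine h.congr ?_
      filter_upwards [aux_diag n hn] with p hp
      simp only [Function.uncurry]
      have h1 := aux_gamma2 ha (r := (∑ j, (p.1 j - p.2 j) ^ 2) / 4) (by positivity)
      have h2 : ∀ t ∈ Set.Ioi (0:ℝ),
        ‖((t ^ (-a - 1) * Real.exp (-((∑ j, (p.1 j - p.2 j) ^ 2) / 4 / t)) : ℝ) : ℂ) *
        (u p.1 * (starRingEnd ℂ) (u p.2))‖ =
        (t ^ (-a - 1) * Real.exp (-((∑ j, (p.1 j - p.2 j) ^ 2) / 4 / t))) *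
          ‖u p.1 * (starRingEnd ℂ) (u p.2)‖ := by
        intro t ht
        have ht : 0 < t := ht
        rw [norm_mul, Complex.norm_real, Real.norm_of_nonneg (by positivity)]
      rw [setIntegral_congr_fun measurableSet_Ioi h2, integral_mul_const, h1,
        norm_mul, Complex.norm_real, Real.norm_of_nonneg (by positivity), div_eq_mul_one_div (∑ j, (p.1 j - p.2 j) ^ 2) 4,
        Real.mul_rpow hp.le (by norm_num)]
      ring
  · refine Measurable.aestronglyMeasurable ?_
    have m1 : Measurable fun q : ((Fin n → ℝ) × (Fin n → ℝ)) × ℝ =>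
      ((q.2 ^ (-a - 1) * Real.exp (-((∑ j, (q.1.1 j - q.1.2 j) ^ 2) / 4 / q.2)) : ℝ) : ℂ) := by
      fun_prop
    exact m1.mul (m2.measurable.comp measurable_fst)

lemma aux_A_eq (n : ℕ) (hn : 1 ≤ n) {a : ℝ} (ha : 0 < a) (u : SchwartzMap (Fin n → ℝ) ℂ) :
    ∫ p : (Fin n → ℝ) × (Fin n → ℝ), (∫ t in Set.Ioi (0:ℝ),
      ((t ^ (-a - 1) * Real.exp (-((∑ j, (p.1 j - p.2 j) ^ 2) / 4 / t)) : ℝ) : ℂ) *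
        (u p.1 * (starRingEnd ℂ) (u p.2))) ∂(volume.prod volume)
    = ((Real.Gamma a * (1/4:ℝ) ^ (-a) : ℝ) : ℂ) * ∫ p : (Fin n → ℝ) × (Fin n → ℝ),
        (((∑ j, (p.1 j - p.2 j) ^ 2) ^ (-a) : ℝ) : ℂ) *
          (u p.1 * (starRingEnd ℂ) (u p.2)) ∂(volume.prod volume) := by
  rw [← integral_const_mul]
  refine integral_congr_ae ?_
  filter_upwards [aux_diag n hn] with p hp
  have h1 := aux_gamma2 ha (r := (∑ j, (p.1 j - p.2 j) ^ 2) / 4) (by positivity)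
  rw [integral_mul_const, integral_complex_ofReal, h1, div_eq_mul_one_div (∑ j, (p.1 j - p.2 j) ^ 2) 4,
        Real.mul_rpow hp.le (by norm_num)]
  push_cast; ring

/-- The time slice identity. -/
lemma aux_slice (n : ℕ) {μ : ℝ} (u : SchwartzMap (Fin n → ℝ) ℂ) {t : ℝ} (ht : 0 < t) :
    ∫ p : (Fin n → ℝ) × (Fin n → ℝ),
      ((t ^ (-((n:ℝ)/2 - μ) - 1) * Real.exp (-((∑ j, (p.1 j - p.2 j) ^ 2) / 4 / t)) : ℝ) : ℂ) *
        (u p.1 * (starRingEnd ℂ) (u p.2)) ∂(volume.prod volume)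
    = (((2 * Real.pi) ^ (n : ℝ) * Real.pi ^ (-((n:ℝ)/2)) *
        ∫ ξ, t ^ (μ - 1) * (‖ftn n u ξ‖ ^ 2 * Real.exp (-(t * ∑ j, ξ j ^ 2))) : ℝ) : ℂ) := by
  rw [integral_const_mul]
  have h := aux_heat n u ht
  simp only [Complex.ofReal_mul] at h ⊢
  rw [← Complex.ofReal_mul] at h
  simp only [mul_assoc] at h ⊢
  rw [integral_const_mul, h]
  simp only [← mul_assoc, ← Complex.ofReal_mul]
  congr 2
  have hp := Real.pi_pos
  rw [Real.div_rpow hp.le ht.le, Real.rpow_neg hp.le, Real.rpow_neg (by positivity : 0 ≤ 2 * Real.pi),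
    show -((n:ℝ)/2 - μ) - 1 = (μ - 1) - (n:ℝ)/2 by ring, Real.rpow_sub ht]
  field_simp

lemma aux_B (n : ℕ) {μ : ℝ} (hμ : μ < (n:ℝ)/2) (hn : 1 ≤ n) (hμ1 : 0 < μ)
    (u : SchwartzMap (Fin n → ℝ) ℂ) :
    Integrable (Function.uncurry fun (t : ℝ) (ξ : Fin n → ℝ) =>
      t ^ (μ - 1) * (‖ftn n u ξ‖ ^ 2 * Real.exp (-(t * ∑ j, ξ j ^ 2))))
      ((volume.restrict (Set.Ioi (0:ℝ))).prod volume) := by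
  have hf := aux_ftn_sm n u
  obtain ⟨C, hC⟩ := aux_ftn_bdd n u
  rw [integrable_prod_iff]
  · constructor
    · refine (ae_restrict_iff' measurableSet_Ioi).2 (Filter.Eventually.of_forall fun t ht => ?_)
      simp only [Function.uncurry]
      refine Integrable.const_mul ?_ _
      refine Integrable.bdd_mul (c := C ^ 2) ?_ ?_ (Filter.Eventually.of_forall fun ξ => ?_)
      · have := (aux_gauss_int n ht).re
        refine this.congr (Filter.Eventually.of_forall fun ξ => ?_)
        simp only [RCLike.re_to_complex, Complex.ofReal_re]
      · exact (hf.norm.pow 2).aestronglyMeasurable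
      · rw [norm_pow, norm_norm]
        gcongr
        exact hC ξ
    · have h := (aux_A n hn (a := (n:ℝ)/2 - μ) (by linarith) (by linarith) u).swap.integral_prod_left.re
      have h2 := h.const_mul ((2 * Real.pi) ^ (n : ℝ) * Real.pi ^ (-((n:ℝ)/2)))⁻¹
      refine h2.congr ?_
      refine (ae_restrict_iff' measurableSet_Ioi).2 (Filter.Eventually.of_forall fun t ht => ?_)
      have ht : 0 < t := ht
      simp only [Function.comp, Function.uncurry, Prod.swap]
      rw [aux_slice n u ht]
      simp only [RCLike.re_to_complex, Complex.ofReal_re]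
      have hp := Real.pi_pos
      rw [inv_mul_cancel_left₀ (by positivity)]
      congr 1; funext ξ
      rw [Real.norm_of_nonneg (by positivity)]
  · refine Measurable.aestronglyMeasurable ?_
    have m0 := hf.measurable
    simp only [Function.uncurry_def]
    fun_prop

lemma aux_B_eq (n : ℕ) {μ : ℝ} (hn : 1 ≤ n) (hμ1 : 0 < μ)
    (u : SchwartzMap (Fin n → ℝ) ℂ) :
    ∫ ξ : Fin n → ℝ, ∫ t in Set.Ioi (0:ℝ),
      t ^ (μ - 1) * (‖ftn n u ξ‖ ^ 2 * Real.exp (-(t * ∑ j, ξ j ^ 2))) =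
    Real.Gamma μ * ∫ ξ : Fin n → ℝ, ‖ftn n u ξ‖ ^ 2 * (∑ j, ξ j ^ 2) ^ (-μ) := by
  rw [← integral_const_mul]
  refine integral_congr_ae ?_
  filter_upwards [aux_ne n hn] with ξ hξ
  simp only [mul_left_comm _ (‖ftn n u ξ‖ ^ 2)]
  rw [integral_const_mul, aux_gamma1 hμ1 hξ]
  ring

lemma aux_const (n : ℕ) {μ : ℝ} :
    ((2 : ℝ) ^ (-(2 * μ)) * Real.Gamma ((n : ℝ) / 2 - μ) /
          (Real.pi ^ ((n : ℝ) / 2) * Real.Gamma μ)) =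
    (Real.Gamma μ)⁻¹ * ((2 * Real.pi) ^ (n : ℝ) * Real.pi ^ (-((n:ℝ)/2)))⁻¹ *
      (Real.Gamma ((n : ℝ) / 2 - μ) * (1/4:ℝ) ^ (-((n : ℝ) / 2 - μ))) := by
  have hp := Real.pi_pos
  have h4 : (1/4:ℝ) ^ (-((n : ℝ) / 2 - μ)) = 2 ^ (n:ℝ) * 2 ^ (-(2*μ)) := by
    rw [show (1/4:ℝ) = 2 ^ (-2:ℝ) by rw [Real.rpow_neg (by norm_num)]; norm_num,
      ← Real.rpow_mul (by norm_num), ← Real.rpow_add (by norm_num)]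
    congr 1; ring
  have h5 : Real.pi ^ (n:ℝ) = Real.pi ^ ((n:ℝ)/2) * Real.pi ^ ((n:ℝ)/2) := by
    rw [← Real.rpow_add hp]; congr 1; ring
  rw [h4, Real.mul_rpow (by norm_num) hp.le, Real.rpow_neg hp.le, h5]
  have := Real.rpow_pos_of_pos hp ((n:ℝ)/2)
  have := Real.rpow_pos_of_pos (two_pos : (0:ℝ) < 2) (n:ℝ)
  field_simp

/-- For `0 < μ < n/2` and `u` Schwartz, `∫∫ |x−y|^{2μ−n} u(x) conj(u(y)) dx dy` converges
absolutely and
`(2^{−2μ} Γ(n/2−μ))/(π^{n/2} Γ(μ)) ∫∫ |x−y|^{2μ−n} u(x) conj(u(y)) dx dy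
  = ∫ |𝓕u(ξ)|² |ξ|^{−2μ} dξ`. -/
theorem statement8 (n : ℕ) (hn : 1 ≤ n) (μ : ℝ) (hμ1 : 0 < μ) (hμ2 : μ < (n : ℝ) / 2)
    (u : SchwartzMap (Fin n → ℝ) ℂ) :
    Integrable (fun p : (Fin n → ℝ) × (Fin n → ℝ) =>
        (((∑ j, (p.1 j - p.2 j) ^ 2) ^ ((2 * μ - (n : ℝ)) / 2) : ℝ) : ℂ) *
          (u p.1 * (starRingEnd ℂ) (u p.2))) volume
    ∧ (((2 : ℝ) ^ (-(2 * μ)) * Real.Gamma ((n : ℝ) / 2 - μ) /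
          (Real.pi ^ ((n : ℝ) / 2) * Real.Gamma μ) : ℝ) : ℂ) *
        ∫ x : Fin n → ℝ, ∫ y : Fin n → ℝ,
          (((∑ j, (x j - y j) ^ 2) ^ ((2 * μ - (n : ℝ)) / 2) : ℝ) : ℂ) *
            (u x * (starRingEnd ℂ) (u y))
      = ((∫ ξ : Fin n → ℝ, ‖ftn n u ξ‖ ^ 2 * (∑ j, ξ j ^ 2) ^ (-μ) : ℝ) : ℂ) := by
  have hexp : (2 * μ - (n : ℝ)) / 2 = -((n : ℝ) / 2 - μ) := by ring
  rw [hexp]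
  have ha : 0 < (n : ℝ) / 2 - μ := by linarith
  have ha2 : 2 * ((n : ℝ) / 2 - μ) < n := by linarith
  have hk := aux_kint n hn ha ha2 u
  refine ⟨hk, ?_⟩
  have hsw := integral_integral_swap (aux_A n hn ha ha2 u)
  rw [aux_A_eq n hn ha u, setIntegral_congr_fun measurableSet_Ioi
    (fun t ht => aux_slice n u ht), integral_complex_ofReal, integral_const_mul,
    integral_integral_swap (aux_B n hμ2 hn hμ1 u), aux_B_eq n hn hμ1 u] at hsw
  rw [integral_prod _ hk] at hsw
  rw [aux_const, Complex.ofReal_mul, mul_assoc, hsw, ← Complex.ofReal_mul]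
  have hg := Real.Gamma_pos_of_pos hμ1
  have hp := Real.pi_pos
  congr 1
  field_simp
end

section
/- Let n ≥ 2, 2-n < a < 1, and let f be a Schwartz function on ℝ^{n-1}. Define g : ℝⁿ → ℂ by g(ξ', ξ_n) = (√2 Γ((2−a)/2)/Γ((1−a)/2)) · 𝓕f(ξ') |ξ'|^{1−a} (|ξ'|² + ξ_n²)^{(a−2)/2}. Then g ∈ L¹(ℝⁿ) and for every x = (x', x_n) ∈ ℝ^{n-1} × ℝ with x_n ≠ 0, P_a f(x) = (2π)^{−n/2} ∫_{ℝⁿ} e^{i x·ξ} g(ξ) dξ; that is, the Fourier transform of the Poisson extension P_a f is the explicit function g. -/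
open MeasureTheory
open Complex (I)

/-- The constant `c_{n,a} = π^{-(n-1)/2} Γ((n-a)/2) / Γ((1-a)/2)`. -/
noncomputable def poissonConst (n : ℕ) (a : ℝ) : ℝ :=
  Real.pi ^ (-(((n : ℝ) - 1) / 2)) * Real.Gamma (((n : ℝ) - a) / 2) / Real.Gamma ((1 - a) / 2)

/-- The Poisson transform `P_a f` on `ℝⁿ = ℝ^{n-1} × ℝ`. -/
noncomputable def poissonTransform (n : ℕ) (a : ℝ) (f : (Fin (n - 1) → ℝ) → ℂ)
    (x : (Fin (n - 1) → ℝ) × ℝ) : ℂ :=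
  (poissonConst n a : ℂ) *
    ∫ y : Fin (n - 1) → ℝ,
      ((|x.2| ^ (1 - a) * ((∑ j, (x.1 j - y j) ^ 2) + x.2 ^ 2) ^ (-(((n : ℝ) - a) / 2)) : ℝ) : ℂ)
        * f y

/-- The Fourier transform `𝓕f(ξ') = (2π)^{-(n-1)/2} ∫ e^{-i y·ξ'} f(y) dy` on `ℝ^{n-1}`. -/
noncomputable def ftb (n : ℕ) (f : (Fin (n - 1) → ℝ) → ℂ) (ξ : Fin (n - 1) → ℝ) : ℂ :=
  (((2 * Real.pi) ^ (-(((n : ℝ) - 1) / 2)) : ℝ) : ℂ) *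
    ∫ y : Fin (n - 1) → ℝ, Complex.exp (-I * ((∑ j, y j * ξ j : ℝ) : ℂ)) * f y

/-- The function `g(ξ', ξ_n) = (√2 Γ((2−a)/2)/Γ((1−a)/2)) 𝓕f(ξ') |ξ'|^{1−a}
(|ξ'|² + ξ_n²)^{(a−2)/2}`, the claimed Fourier transform of `P_a f`. -/
noncomputable def gFun (n : ℕ) (a : ℝ) (f : (Fin (n - 1) → ℝ) → ℂ)
    (ξ : (Fin (n - 1) → ℝ) × ℝ) : ℂ :=
  ((Real.sqrt 2 * Real.Gamma ((2 - a) / 2) / Real.Gamma ((1 - a) / 2) : ℝ) : ℂ) *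
    ftb n f ξ.1 *
    (((∑ j, ξ.1 j ^ 2) ^ ((1 - a) / 2) *
        ((∑ j, ξ.1 j ^ 2) + ξ.2 ^ 2) ^ ((a - 2) / 2) : ℝ) : ℂ)


open Set

/-- Inversion `u ↦ 1/u` on `(0,∞)`. -/
lemma pt_inv (g : ℝ → ℝ) :
    ∫ u in Ioi (0:ℝ), u ^ (-2:ℝ) * g (u⁻¹) = ∫ t in Ioi (0:ℝ), g t := by
  rw [← integral_comp_rpow_Ioi g (p := -1) (by norm_num)]
  refine setIntegral_congr_fun measurableSet_Ioi fun u hu => ?_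
  simp only [smul_eq_mul, Real.rpow_neg_one]
  norm_num

lemma pt_gamma_aux {p u : ℝ} (hu : 0 < u) :
    u ^ (-2:ℝ) * (u⁻¹) ^ (p - 1) = u ^ (-p - 1) := by
  rw [Real.inv_rpow hu.le, ← Real.rpow_neg hu.le, ← Real.rpow_add hu]
  congr 1; ring

lemma pt_gamma_int {p A : ℝ} (hp : 0 < p) (hA : 0 < A) :
    IntegrableOn (fun u : ℝ => u ^ (-p - 1) * Real.exp (-(A / u))) (Ioi 0) := by
  have h : IntegrableOn (fun t : ℝ => t ^ (p - 1) * Real.exp (-A * t ^ (1:ℝ))) (Ioi 0) :=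
    integrableOn_rpow_mul_exp_neg_mul_rpow (by linarith) one_pos hA
  have h2 := (integrableOn_Ioi_comp_rpow_iff _ (p := -1) (by norm_num)).mpr h
  refine h2.congr_fun (fun u hu => ?_) measurableSet_Ioi
  simp only [smul_eq_mul, Real.rpow_neg_one, Real.rpow_one]
  rw [← pt_gamma_aux (p := p) (u := u) hu]
  norm_num
  rw [mul_assoc, div_eq_mul_inv]

lemma pt_gamma {p A : ℝ} (hp : 0 < p) (hA : 0 < A) :
    ∫ u in Ioi (0:ℝ), u ^ (-p - 1) * Real.exp (-(A / u)) = Real.Gamma p * A ^ (-p) := by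
  have h := Real.integral_rpow_mul_exp_neg_mul_Ioi hp hA
  rw [← pt_inv] at h
  rw [Real.rpow_neg hA.le, ← Real.inv_rpow hA.le, ← one_div, mul_comm, ← h]
  refine setIntegral_congr_fun measurableSet_Ioi fun u hu => ?_
  rw [← mul_assoc, pt_gamma_aux hu, div_eq_mul_inv]

/-- The key change of variables `t = X / (r u)`. -/
lemma pt_bessel {ν r X : ℝ} (hr : 0 < r) (hX : 0 < X) :
    r ^ ν * ∫ t in Ioi (0:ℝ), t ^ (ν - 1) * (Real.exp (-(t * r)) * Real.exp (-(X / t)))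
      = X ^ ν * ∫ u in Ioi (0:ℝ), u ^ (-ν - 1) * Real.exp (-(X / u)) * Real.exp (-(u * r)) := by
  have hk : 0 < r / X := by positivity
  rw [← pt_inv]
  have hsc := integral_comp_mul_left_Ioi' (fun u : ℝ => u ^ (-2:ℝ) * (u⁻¹ ^ (ν - 1) *
    (Real.exp (-(u⁻¹ * r)) * Real.exp (-(X / u⁻¹))))) 0 hk
  rw [mul_zero, smul_eq_mul] at hsc
  rw [← hsc, ← integral_const_mul, ← integral_const_mul, ← integral_const_mul]
  refine setIntegral_congr_fun measurableSet_Ioi fun u (hu : 0 < u) => ?_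
  rw [← mul_assoc ((r / X * u) ^ (-2:ℝ)), pt_gamma_aux (by positivity)]
  have e1 : (r / X * u)⁻¹ * r = X / u := by field_simp
  have e2 : X / (r / X * u)⁻¹ = u * r := by field_simp
  rw [e1, e2, Real.mul_rpow hk.le hu.le]
  have e3 : r ^ ν * (r / X * (r / X) ^ (-ν - 1)) = X ^ ν := by
    rw [Real.rpow_sub hk, Real.rpow_one, mul_div_cancel₀ _ hk.ne', Real.rpow_neg hk.le,
      Real.div_rpow hr.le hX.le]
    have := (Real.rpow_pos_of_pos hr ν).ne'
    have := (Real.rpow_pos_of_pos hX ν).ne'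
    field_simp
  rw [← e3]; ring

lemma pt_s_int {σ r : ℝ} (hσ : 1 / 2 < σ) (hr : 0 < r) :
    Integrable (fun s : ℝ => (r + s ^ 2) ^ (-σ)) := by
  have h : Integrable (fun x : ℝ => ((1:ℝ) + ‖x‖ ^ 2) ^ (-(2 * σ) / 2)) :=
    integrable_rpow_neg_one_add_norm_sq (by simp; linarith)
  have hs : 0 < √r := Real.sqrt_pos.mpr hr
  have h2 := (h.comp_mul_left' (R := (√r)⁻¹) (by positivity)).const_mul (r ^ (-σ))
  refine h2.congr (Filter.Eventually.of_forall fun s => ?_)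
  dsimp only
  rw [show -(2 * σ) / 2 = -σ by ring, ← Real.mul_rpow hr.le (by positivity)]
  congr 1
  rw [Real.norm_eq_abs, sq_abs, mul_pow, inv_pow, Real.sq_sqrt hr.le]
  field_simp

lemma pt_s_norm {ν σ : ℝ} (hσ : σ = ν + 1 / 2) {r : ℝ} (hr : 0 < r) :
    ∫ s : ℝ, r ^ ν * (r + s ^ 2) ^ (-σ) = ∫ s : ℝ, (1 + s ^ 2) ^ (-σ) := by
  have hs : 0 < √r := Real.sqrt_pos.mpr hr
  have h := Measure.integral_comp_mul_left (fun s : ℝ => r ^ ν * (r + s ^ 2) ^ (-σ)) (√r)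
  rw [abs_of_pos (by positivity), smul_eq_mul, inv_mul_eq_div, eq_div_iff hs.ne'] at h
  rw [← h, mul_comm, ← integral_const_mul]
  congr 1; ext s
  rw [mul_pow, Real.sq_sqrt hr.le, show r + r * s ^ 2 = r * (1 + s ^ 2) by ring,
    Real.mul_rpow hr.le (by positivity), Real.sqrt_eq_rpow]
  have : r ^ (1 / 2 : ℝ) * (r ^ ν * r ^ (-σ)) = 1 := by
    rw [← Real.rpow_add hr, ← Real.rpow_add hr, hσ]
    rw [show (1 / 2 + (ν + -(ν + 1 / 2)) : ℝ) = 0 by ring, Real.rpow_zero]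
  linear_combination (1 + s ^ 2) ^ (-σ) * this

lemma pt_gauss1 {t : ℝ} (ht : 0 < t) (x : ℝ) :
    ∫ s : ℝ, Complex.exp (I * ((x * s : ℝ) : ℂ)) * ((Real.exp (-(t * s ^ 2)) : ℝ) : ℂ)
      = ((√Real.pi * t ^ (-(1/2) : ℝ) * Real.exp (-(x ^ 2 / 4 / t)) : ℝ) : ℂ) := by
  have h := fourierIntegral_gaussian (b := (t : ℂ)) (by simpa using ht) (x : ℂ)
  have e : (fun s : ℝ => Complex.exp (I * ((x * s : ℝ) : ℂ)) * ((Real.exp (-(t * s ^ 2)) : ℝ) : ℂ))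
      = fun s : ℝ => Complex.exp (I * x * s) * Complex.exp (-t * s ^ 2) := by
    ext s; push_cast; congr 2 <;> ring
  rw [e, h]
  have e2 : ((Real.pi : ℂ) / t) ^ (1 / 2 : ℂ) = ((√Real.pi * t ^ (-(1/2) : ℝ) : ℝ) : ℂ) := by
    rw [Real.sqrt_eq_rpow, Real.rpow_neg ht.le, ← div_eq_mul_inv,
      ← Real.div_rpow Real.pi_pos.le ht.le, Complex.ofReal_cpow (by positivity)]
    push_cast; rfl
  rw [e2]; push_cast; congr 2
  have : (t : ℂ) ≠ 0 := by exact_mod_cast ht.ne'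
  field_simp

/-- The Fourier integral in the last variable. -/
lemma pt_s_fourier {ν σ : ℝ} (hν : 0 < ν) (hσ : σ = ν + 1 / 2) {r : ℝ} (hr : 0 < r)
    {x : ℝ} (hx : x ≠ 0) :
    ∫ s : ℝ, Complex.exp (I * ((x * s : ℝ) : ℂ)) * ((r ^ ν * (r + s ^ 2) ^ (-σ) : ℝ) : ℂ)
      = ((√Real.pi / Real.Gamma σ * (x ^ 2 / 4) ^ ν * ∫ u in Ioi (0:ℝ),
          u ^ (-ν - 1) * Real.exp (-(x ^ 2 / 4 / u)) * Real.exp (-(u * r)) : ℝ) : ℂ) := by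
  have hσ0 : 0 < σ := by linarith
  have hΓ : 0 < Real.Gamma σ := Real.Gamma_pos_of_pos hσ0
  have hA : ∀ s : ℝ, 0 < r + s ^ 2 := fun s => by positivity
  have key : ∀ s : ℝ, ∫ t in Ioi (0:ℝ), t ^ (σ - 1) * Real.exp (-((r + s ^ 2) * t))
      = Real.Gamma σ * (r + s ^ 2) ^ (-σ) := fun s => by
    rw [Real.integral_rpow_mul_exp_neg_mul_Ioi hσ0 (hA s), one_div, Real.inv_rpow (hA s).le,
      Real.rpow_neg (hA s).le, mul_comm]
  let G : ℝ → ℝ → ℂ := fun s t => Complex.exp (I * ((x * s : ℝ) : ℂ)) *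
    ((t ^ (σ - 1) * Real.exp (-((r + s ^ 2) * t)) : ℝ) : ℂ)
  have hnorm : ∀ s : ℝ, ‖Complex.exp (I * ((x * s : ℝ) : ℂ))‖ = 1 := fun s => by
    rw [mul_comm]; exact Complex.norm_exp_ofReal_mul_I _
  have hG : Integrable (Function.uncurry G) (volume.prod (volume.restrict (Ioi 0))) := by
    rw [integrable_prod_iff]
    · refine ⟨Filter.Eventually.of_forall fun s => ?_, ?_⟩
      · have h : IntegrableOn (fun t : ℝ => t ^ (σ - 1) * Real.exp (-(r + s ^ 2) * t ^ (1:ℝ)))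
            (Ioi 0) :=
          integrableOn_rpow_mul_exp_neg_mul_rpow (by linarith) one_pos (hA s)
        simp only [Real.rpow_one, neg_mul] at h
        exact (Integrable.ofReal (𝕜 := ℂ) h).const_mul (Complex.exp (I * ((x * s : ℝ) : ℂ)))
      · have h := (pt_s_int (σ := σ) (by linarith) hr).const_mul (Real.Gamma σ)
        refine h.congr (Filter.Eventually.of_forall fun s => ?_)
        dsimp only
        rw [← key s]
        refine setIntegral_congr_fun measurableSet_Ioi fun t (ht : 0 < t) => ?_
        simp only [Function.uncurry, G, norm_mul, hnorm, one_mul, Complex.norm_real]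
        rw [Real.norm_of_nonneg (by positivity), Real.norm_of_nonneg (by positivity)]
    · apply Measurable.aestronglyMeasurable
      simp only [Function.uncurry_def, G]
      fun_prop
  have hsw := integral_integral_swap hG
  have e1 : ∀ s : ℝ, ∫ t in Ioi (0:ℝ), G s t = (Real.Gamma σ : ℂ) *
      (Complex.exp (I * ((x * s : ℝ) : ℂ)) * (((r + s ^ 2) ^ (-σ) : ℝ) : ℂ)) := fun s => by
    simp only [G]
    rw [integral_const_mul, integral_complex_ofReal, key s]; push_cast; ring
  have e2 : ∫ t in Ioi (0:ℝ), ∫ s : ℝ, G s t = ((√Real.pi * ∫ t in Ioi (0:ℝ),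
      t ^ (ν - 1) * (Real.exp (-(t * r)) * Real.exp (-(x ^ 2 / 4 / t))) : ℝ) : ℂ) := by
    rw [← integral_const_mul, ← integral_complex_ofReal]
    refine setIntegral_congr_fun measurableSet_Ioi fun t (ht : 0 < t) => ?_
    have : ∀ s, G s t = ((t ^ (σ - 1) * Real.exp (-(t * r)) : ℝ) : ℂ) *
        (Complex.exp (I * ((x * s : ℝ) : ℂ)) * ((Real.exp (-(t * s ^ 2)) : ℝ) : ℂ)) := fun s => by
      simp only [G]
      rw [show -((r + s ^ 2) * t) = -(t * r) + -(t * s ^ 2) by ring, Real.exp_add]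
      push_cast; ring
    simp only [this]
    rw [integral_const_mul, pt_gauss1 ht, ← Complex.ofReal_mul]
    congr 1
    have : t ^ (ν - 1) = t ^ (σ - 1) * t ^ (-(1/2) : ℝ) := by
      rw [← Real.rpow_add ht, hσ]; congr 1; ring
    rw [this]; ring
  simp only [e1] at hsw
  rw [e2, integral_const_mul] at hsw
  have e3 : ∫ s : ℝ, Complex.exp (I * ((x * s : ℝ) : ℂ)) * ((r ^ ν * (r + s ^ 2) ^ (-σ) : ℝ) : ℂ)
      = ((r ^ ν : ℝ) : ℂ) * ∫ s : ℝ, Complex.exp (I * ((x * s : ℝ) : ℂ)) *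
        (((r + s ^ 2) ^ (-σ) : ℝ) : ℂ) := by
    rw [← integral_const_mul]; congr 1; ext s; push_cast; ring
  have hb := pt_bessel (ν := ν) hr (X := x ^ 2 / 4) (by positivity)
  rw [e3, mul_assoc, ← hb]
  have hΓ' : (Real.Gamma σ : ℂ) ≠ 0 := by exact_mod_cast hΓ.ne'
  rw [← mul_right_inj' hΓ', mul_left_comm, hsw]
  rw [Complex.ofReal_mul, Complex.ofReal_mul, Complex.ofReal_mul]
  generalize ((∫ t in Ioi (0:ℝ), _ : ℝ) : ℂ) = J
  push_cast; field_simp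

open scoped FourierTransform in
lemma pt_F_nice {ι : Type*} [Fintype ι] (f : SchwartzMap (ι → ℝ) ℂ) :
    Integrable (fun ξ : ι → ℝ => ∫ y : ι → ℝ,
      Complex.exp (-I * ((∑ j, y j * ξ j : ℝ) : ℂ)) * f y) ∧
    Continuous (fun ξ : ι → ℝ => ∫ y : ι → ℝ,
      Complex.exp (-I * ((∑ j, y j * ξ j : ℝ) : ℂ)) * f y) := by
  let h : SchwartzMap (EuclideanSpace ℝ ι) ℂ :=
    SchwartzMap.compCLMOfContinuousLinearEquiv ℂ (EuclideanSpace.equiv ι ℝ) f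
  have e : (fun ξ : ι → ℝ => ∫ y : ι → ℝ,
      Complex.exp (-I * ((∑ j, y j * ξ j : ℝ) : ℂ)) * f y)
      = fun ξ => (𝓕 h) (WithLp.toLp 2 ((2 * Real.pi)⁻¹ • ξ)) := by
    ext ξ
    rw [SchwartzMap.fourier_coe, Real.fourier_eq',
      ← (PiLp.volume_preserving_toLp ι).integral_comp
        (MeasurableEquiv.toLp 2 (ι → ℝ)).measurableEmbedding]
    congr 1; ext y
    have : h (WithLp.toLp 2 y) = f y := rfl
    rw [this, smul_eq_mul]
    congr 2
    have hp : (Real.pi : ℂ) ≠ 0 := by exact_mod_cast Real.pi_ne_zero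
    rw [PiLp.inner_apply]
    simp only [Pi.smul_apply, smul_eq_mul, RCLike.inner_apply, conj_trivial]
    rw [show (-I : ℂ) = ((-1 : ℝ) : ℂ) * I by push_cast; ring, mul_right_comm, ← Complex.ofReal_mul]
    congr 2
    rw [Finset.mul_sum, Finset.mul_sum]
    refine Finset.sum_congr rfl fun j _ => ?_
    have := Real.pi_ne_zero
    field_simp
  rw [e]
  constructor
  · have h1 : Integrable (fun ξ : ι → ℝ => (𝓕 h) (WithLp.toLp 2 ξ)) :=
      (PiLp.volume_preserving_toLp ι).integrable_comp_of_integrable (𝓕 h).integrable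
    exact h1.comp_smul (by positivity)
  · have h2 := (𝓕 h).continuous
    have h3 : Continuous (fun ξ : ι → ℝ => WithLp.toLp 2 ((2 * Real.pi)⁻¹ • ξ)) := by fun_prop
    exact h2.comp h3

lemma pt_gaussm {ι : Type*} [Fintype ι] {u : ℝ} (hu : 0 < u) (z : ι → ℝ) :
    Integrable (fun ξ : ι → ℝ => Complex.exp (I * ((∑ j, z j * ξ j : ℝ) : ℂ)) *
      ((Real.exp (-(u * ∑ j, ξ j ^ 2)) : ℝ) : ℂ)) ∧
    ∫ ξ : ι → ℝ, Complex.exp (I * ((∑ j, z j * ξ j : ℝ) : ℂ)) *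
      ((Real.exp (-(u * ∑ j, ξ j ^ 2)) : ℝ) : ℂ)
      = ((Real.pi ^ ((Fintype.card ι : ℝ) / 2) * u ^ (-((Fintype.card ι : ℝ) / 2)) *
          Real.exp (-((∑ j, z j ^ 2) / 4 / u)) : ℝ) : ℂ) := by
  have hb : 0 < (u : ℂ).re := by simpa using hu
  have e : (fun ξ : ι → ℝ => Complex.exp (I * ((∑ j, z j * ξ j : ℝ) : ℂ)) *
      ((Real.exp (-(u * ∑ j, ξ j ^ 2)) : ℝ) : ℂ)) = fun ξ : ι → ℝ =>
      Complex.exp (-u * ∑ i, (ξ i : ℂ) ^ 2 + ∑ i, (I * z i) * ξ i) := by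
    ext ξ
    push_cast
    rw [← Complex.exp_add]; congr 1
    simp only [mul_assoc, ← Finset.mul_sum]; ring
  rw [e]
  refine ⟨GaussianFourier.integrable_cexp_neg_mul_sum_add hb _, ?_⟩
  rw [GaussianFourier.integral_cexp_neg_mul_sum_add hb]
  have e2 : ((Real.pi : ℂ) / u) ^ (Fintype.card ι / 2 : ℂ) =
      ((Real.pi ^ ((Fintype.card ι : ℝ) / 2) * u ^ (-((Fintype.card ι : ℝ) / 2)) : ℝ) : ℂ) := by
    rw [Real.rpow_neg hu.le, ← div_eq_mul_inv,
      ← Real.div_rpow Real.pi_pos.le hu.le, Complex.ofReal_cpow (by positivity)]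
    push_cast; rfl
  rw [e2]; push_cast; congr 2
  have : (u : ℂ) ≠ 0 := by exact_mod_cast hu.ne'
  simp only [mul_pow, Complex.I_sq, ← Finset.mul_sum]
  field_simp

lemma pt_phase {x : ℝ} : ‖Complex.exp (I * (x : ℂ))‖ = 1 := by
  rw [mul_comm]; exact Complex.norm_exp_ofReal_mul_I _

lemma pt_fourier_gauss {ι : Type*} [Fintype ι] (f : SchwartzMap (ι → ℝ) ℂ) {u : ℝ} (hu : 0 < u)
    (x : ι → ℝ) :
    ∫ ξ : ι → ℝ, Complex.exp (I * ((∑ j, x j * ξ j : ℝ) : ℂ)) *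
      (∫ y : ι → ℝ, Complex.exp (-I * ((∑ j, y j * ξ j : ℝ) : ℂ)) * f y) *
      ((Real.exp (-(u * ∑ j, ξ j ^ 2)) : ℝ) : ℂ)
    = ∫ y : ι → ℝ, ((Real.pi ^ ((Fintype.card ι : ℝ) / 2) * u ^ (-((Fintype.card ι : ℝ) / 2)) *
          Real.exp (-((∑ j, (x j - y j) ^ 2) / 4 / u)) : ℝ) : ℂ) * f y := by
  let G : (ι → ℝ) → (ι → ℝ) → ℂ := fun ξ y =>
    (Complex.exp (I * ((∑ j, (x j - y j) * ξ j : ℝ) : ℂ)) *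
      ((Real.exp (-(u * ∑ j, ξ j ^ 2)) : ℝ) : ℂ)) * f y
  have hG : Integrable (Function.uncurry G) (volume.prod volume) := by
    have h1 := ((pt_gaussm hu (0 : ι → ℝ)).1.mul_prod (f.integrable (μ := volume)))
    refine h1.mono ?_ (Filter.Eventually.of_forall fun p => ?_)
    · refine Continuous.aestronglyMeasurable ?_
      have := f.continuous
      simp only [Function.uncurry_def, G]
      fun_prop
    · simp only [Function.uncurry, G, norm_mul, pt_phase]; exact le_rfl
  have e1 : ∀ ξ : ι → ℝ, Complex.exp (I * ((∑ j, x j * ξ j : ℝ) : ℂ)) *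
      (∫ y : ι → ℝ, Complex.exp (-I * ((∑ j, y j * ξ j : ℝ) : ℂ)) * f y) *
      ((Real.exp (-(u * ∑ j, ξ j ^ 2)) : ℝ) : ℂ) = ∫ y, G ξ y := fun ξ => by
    rw [← integral_const_mul, ← integral_mul_const]
    congr 1; ext y
    simp only [G, sub_mul, Finset.sum_sub_distrib]
    rw [Complex.ofReal_sub, mul_sub, sub_eq_add_neg, Complex.exp_add, neg_mul]
    ring
  simp only [e1]
  rw [integral_integral_swap hG]
  congr 1; ext y
  simp only [G]
  rw [integral_mul_const, (pt_gaussm hu (fun j => x j - y j)).2]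

lemma pt_core {ι : Type*} [Fintype ι] (f : SchwartzMap (ι → ℝ) ℂ) {ν X : ℝ} (hν : 0 < ν)
    (hX : 0 < X) (x : ι → ℝ) :
    ∫ ξ : ι → ℝ, Complex.exp (I * ((∑ j, x j * ξ j : ℝ) : ℂ)) *
      (∫ y : ι → ℝ, Complex.exp (-I * ((∑ j, y j * ξ j : ℝ) : ℂ)) * f y) *
      ((∫ u in Ioi (0:ℝ), u ^ (-ν - 1) * Real.exp (-(X / u)) *
        Real.exp (-(u * ∑ j, ξ j ^ 2)) : ℝ) : ℂ)
    = ∫ y : ι → ℝ, ((Real.pi ^ ((Fintype.card ι : ℝ) / 2) *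
        (Real.Gamma (ν + (Fintype.card ι : ℝ) / 2) *
          ((∑ j, (x j - y j) ^ 2) / 4 + X) ^ (-(ν + (Fintype.card ι : ℝ) / 2))) : ℝ) : ℂ) * f y := by
  obtain ⟨hFi, hFc⟩ := pt_F_nice f
  set F : (ι → ℝ) → ℂ := fun ξ => ∫ y : ι → ℝ,
    Complex.exp (-I * ((∑ j, y j * ξ j : ℝ) : ℂ)) * f y with hF
  set k : ℝ := (Fintype.card ι : ℝ) / 2 with hk
  have hk0 : 0 ≤ k := by positivity
  let G : (ι → ℝ) → ℝ → ℂ := fun ξ u => Complex.exp (I * ((∑ j, x j * ξ j : ℝ) : ℂ)) * F ξ *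
    ((u ^ (-ν - 1) * Real.exp (-(X / u)) * Real.exp (-(u * ∑ j, ξ j ^ 2)) : ℝ) : ℂ)
  have hfc := f.continuous
  have hG : Integrable (Function.uncurry G) (volume.prod (volume.restrict (Ioi 0))) := by
    have h1 := hFi.mul_prod (Integrable.ofReal (𝕜 := ℂ) (pt_gamma_int hν hX))
    refine h1.mono ?_ ?_
    · apply Measurable.aestronglyMeasurable
      have := hFc.measurable
      simp only [Function.uncurry_def, G]
      fun_prop
    · have : ∀ᵐ p : (ι → ℝ) × ℝ ∂(volume.prod (volume.restrict (Ioi 0))), 0 < p.2 := by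
        have h0 : ∀ᵐ u : ℝ ∂(volume.restrict (Ioi 0)), 0 < u :=
          ae_restrict_mem measurableSet_Ioi
        exact Measure.quasiMeasurePreserving_snd.ae h0
      filter_upwards [this] with p hp
      simp only [Function.uncurry, G, norm_mul, pt_phase, one_mul, Complex.ofReal_mul]
      refine mul_le_mul_of_nonneg_left ?_ (norm_nonneg _)
      change ‖((_ : ℝ) : ℂ)‖ * ‖((_ : ℝ) : ℂ)‖ * ‖((_ : ℝ) : ℂ)‖ ≤ ‖((_ * _ : ℝ) : ℂ)‖
      rw [Complex.ofReal_mul, norm_mul]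
      refine mul_le_of_le_one_right (mul_nonneg (norm_nonneg _) (norm_nonneg _)) ?_
      rw [Complex.norm_real, Real.norm_of_nonneg (by positivity), Real.exp_le_one_iff, neg_nonpos]
      exact mul_nonneg hp.le (Finset.sum_nonneg fun j _ => sq_nonneg _)
  let H : ℝ → (ι → ℝ) → ℂ := fun u y => ((u ^ (-ν - 1) * Real.exp (-(X / u)) *
    (Real.pi ^ k * u ^ (-k) * Real.exp (-((∑ j, (x j - y j) ^ 2) / 4 / u))) : ℝ) : ℂ) * f y
  have hH : Integrable (Function.uncurry H) ((volume.restrict (Ioi 0)).prod volume) := by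
    have h1 := ((Integrable.ofReal (𝕜 := ℂ) (pt_gamma_int (p := ν + k) (by positivity) hX)).const_mul
      ((Real.pi ^ k : ℝ) : ℂ)).mul_prod (f.integrable (μ := volume))
    refine h1.mono ?_ ?_
    · apply Measurable.aestronglyMeasurable
      have := hfc.measurable
      simp only [Function.uncurry_def, H]
      fun_prop
    · have : ∀ᵐ p : ℝ × (ι → ℝ) ∂((volume.restrict (Ioi 0)).prod volume), 0 < p.1 := by
        have h0 : ∀ᵐ u : ℝ ∂(volume.restrict (Ioi 0)), 0 < u :=
          ae_restrict_mem measurableSet_Ioi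
        exact Measure.quasiMeasurePreserving_fst.ae h0
      filter_upwards [this] with p hp
      have hr : p.1 ^ (-(ν + k) - 1) = p.1 ^ (-ν - 1) * p.1 ^ (-k) := by
        rw [← Real.rpow_add hp]; congr 1; ring
      have h3 : Real.exp (-((∑ j, (x j - p.2 j) ^ 2) / 4 / p.1)) ≤ 1 := by
        rw [Real.exp_le_one_iff, neg_nonpos]
        have : 0 ≤ ∑ j, (x j - p.2 j) ^ 2 := Finset.sum_nonneg fun j _ => sq_nonneg _
        positivity
      simp only [Function.uncurry, H, norm_mul]
      refine mul_le_mul_of_nonneg_right ?_ (norm_nonneg _)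
      change ‖((_ : ℝ) : ℂ)‖ ≤ ‖((_ : ℝ) : ℂ)‖ * ‖((_ : ℝ) : ℂ)‖
      rw [Complex.norm_real, Complex.norm_real, Complex.norm_real,
        Real.norm_of_nonneg (by positivity), Real.norm_of_nonneg (by positivity),
        Real.norm_of_nonneg (by positivity), hr]
      calc _ = (Real.pi ^ k * (p.1 ^ (-ν - 1) * p.1 ^ (-k) * Real.exp (-(X / p.1)))) *
            Real.exp (-((∑ j, (x j - p.2 j) ^ 2) / 4 / p.1)) := by ring
        _ ≤ _ := mul_le_of_le_one_right (by positivity) h3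
  calc _ = ∫ ξ : ι → ℝ, ∫ u in Ioi (0:ℝ), G ξ u := by
        congr 1; ext ξ
        simp only [G]
        rw [integral_const_mul, integral_complex_ofReal]
    _ = ∫ u in Ioi (0:ℝ), ∫ ξ : ι → ℝ, G ξ u := integral_integral_swap hG
    _ = ∫ u in Ioi (0:ℝ), ∫ y : ι → ℝ, H u y := by
        refine setIntegral_congr_fun measurableSet_Ioi fun u (hu : 0 < u) => ?_
        have h := pt_fourier_gauss f hu x
        have e1 : ∀ ξ, G ξ u = ((u ^ (-ν - 1) * Real.exp (-(X / u)) : ℝ) : ℂ) *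
            (Complex.exp (I * ((∑ j, x j * ξ j : ℝ) : ℂ)) * F ξ *
              ((Real.exp (-(u * ∑ j, ξ j ^ 2)) : ℝ) : ℂ)) := fun ξ => by
          simp only [G]; rw [Complex.ofReal_mul]; ring
        simp only [e1]
        rw [integral_const_mul, h, ← integral_const_mul]
        congr 1; ext y
        simp only [H]
        rw [Complex.ofReal_mul (u ^ (-ν - 1) * Real.exp (-(X / u)))]; ring
    _ = ∫ y : ι → ℝ, ∫ u in Ioi (0:ℝ), H u y := integral_integral_swap hH
    _ = _ := by
        congr 1; ext y
        have hq : 0 ≤ ∑ j, (x j - y j) ^ 2 := Finset.sum_nonneg fun j _ => sq_nonneg _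
        simp only [H]
        rw [integral_mul_const, integral_complex_ofReal,
          ← pt_gamma (p := ν + k) (by positivity) (by positivity), ← integral_const_mul]
        congr 2
        refine setIntegral_congr_fun measurableSet_Ioi fun u (hu : 0 < u) => ?_
        have hr : u ^ (-(ν + k) - 1) = u ^ (-ν - 1) * u ^ (-k) := by
          rw [← Real.rpow_add hu]; congr 1; ring
        have he : Real.exp (-(((∑ j, (x j - y j) ^ 2) / 4 + X) / u)) =
            Real.exp (-((∑ j, (x j - y j) ^ 2) / 4 / u)) * Real.exp (-(X / u)) := by
          rw [← Real.exp_add]; congr 1; ring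
        simp only [hr, he]; ring

lemma pt_const {n : ℕ} {a A x : ℝ} (ha : a < 1) (hA : 0 < A) (hx : x ≠ 0) :
    poissonConst n a * (|x| ^ (1 - a) * A ^ (-(((n : ℝ) - a) / 2))) =
    ((2 * Real.pi) ^ (-((n : ℝ) / 2)) *
      (√2 * Real.Gamma ((2 - a) / 2) / Real.Gamma ((1 - a) / 2) *
        (2 * Real.pi) ^ (-(((n : ℝ) - 1) / 2)) *
        (√Real.pi / Real.Gamma ((2 - a) / 2) * (x ^ 2 / 4) ^ ((1 - a) / 2)))) *
      (Real.pi ^ (((n : ℝ) - 1) / 2) * (Real.Gamma (((n : ℝ) - a) / 2) *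
        (A / 4) ^ (-(((n : ℝ) - a) / 2)))) := by
  have hG1 : 0 < Real.Gamma ((2 - a) / 2) := Real.Gamma_pos_of_pos (by linarith)
  have hG2 : 0 < Real.Gamma ((1 - a) / 2) := Real.Gamma_pos_of_pos (by linarith)
  have hpi := Real.pi_pos
  have e1 : (x ^ 2 / 4) ^ ((1 - a) / 2) = |x| ^ (1 - a) * 2 ^ (-(1 - a)) := by
    rw [← sq_abs, show |x| ^ 2 / 4 = (|x| * 2⁻¹) ^ (2:ℝ) by rw [Real.rpow_two]; ring,
      ← Real.rpow_mul (by positivity), mul_div_cancel₀ _ (by norm_num),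
      Real.mul_rpow (by positivity) (by positivity), Real.inv_rpow (by positivity),
      Real.rpow_neg (by positivity)]
  have e2 : (A / 4) ^ (-(((n : ℝ) - a) / 2)) = A ^ (-(((n : ℝ) - a) / 2)) * 2 ^ ((n : ℝ) - a) := by
    rw [Real.div_rpow hA.le (by norm_num), Real.rpow_neg (by norm_num : (0:ℝ) ≤ 4),
      show (4:ℝ) = 2 ^ (2:ℝ) by norm_num, ← Real.rpow_mul (by norm_num),
      mul_div_cancel₀ _ (by norm_num), div_inv_eq_mul]
  have e3 : (2:ℝ) ^ (-((n : ℝ) / 2)) * 2 ^ (1 / 2 : ℝ) * 2 ^ (-(((n : ℝ) - 1) / 2)) *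
      2 ^ (-(1 - a)) * 2 ^ ((n : ℝ) - a) = 1 := by
    rw [← Real.rpow_add two_pos, ← Real.rpow_add two_pos, ← Real.rpow_add two_pos,
      ← Real.rpow_add two_pos]
    convert Real.rpow_zero (2:ℝ) using 2; ring
  have e4 : Real.pi ^ (-((n : ℝ) / 2)) * Real.pi ^ (1 / 2 : ℝ) * Real.pi ^ (-(((n : ℝ) - 1) / 2)) *
      Real.pi ^ (((n : ℝ) - 1) / 2) = Real.pi ^ (-(((n : ℝ) - 1) / 2)) := by
    rw [← Real.rpow_add hpi, ← Real.rpow_add hpi, ← Real.rpow_add hpi]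
    congr 1; ring
  rw [e1, e2, poissonConst, ← e4, Real.mul_rpow two_pos.le hpi.le, Real.mul_rpow two_pos.le hpi.le,
    Real.sqrt_eq_rpow, Real.sqrt_eq_rpow]
  have e5 : Real.Gamma ((2 - a) / 2) * (1 / Real.Gamma ((2 - a) / 2)) = 1 := by field_simp
  generalize Real.Gamma ((2 - a) / 2) = g1 at *
  generalize Real.Gamma ((1 - a) / 2) = g2 at *
  generalize Real.Gamma (((n : ℝ) - a) / 2) = g3 at *
  clear e1 e2 e4
  generalize (2:ℝ) ^ (-((n : ℝ) / 2)) = b1 at *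
  generalize (2:ℝ) ^ (1 / 2 : ℝ) = b2 at *
  generalize (2:ℝ) ^ (-(((n : ℝ) - 1) / 2)) = b3 at *
  generalize (2:ℝ) ^ (-(1 - a)) = b4 at *
  generalize (2:ℝ) ^ ((n : ℝ) - a) = b5 at *
  generalize Real.pi ^ (-((n : ℝ) / 2)) = c1 at *
  generalize Real.pi ^ (1 / 2 : ℝ) = c2 at *
  generalize Real.pi ^ (-(((n : ℝ) - 1) / 2)) = c3 at *
  generalize Real.pi ^ (((n : ℝ) - 1) / 2) = c4 at *
  generalize |x| ^ (1 - a) = d1 at *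
  generalize A ^ (-(((n : ℝ) - a) / 2)) = d2 at *
  have : c1 * c2 * c3 * c4 * g3 / g2 * (d1 * d2) =
    (c1 * c2 * c3 * c4 * g3 / g2 * (d1 * d2)) * (b1 * b2 * b3 * b4 * b5) * (g1 * (1 / g1)) := by
    rw [e3, e5]; ring
  rw [this]; ring

theorem statement9 (n : ℕ) (hn : 2 ≤ n) (a : ℝ) (ha1 : 2 - (n : ℝ) < a) (ha2 : a < 1)
    (f : SchwartzMap (Fin (n - 1) → ℝ) ℂ) :
    Integrable (gFun n a f) volume
    ∧ ∀ x : (Fin (n - 1) → ℝ) × ℝ, x.2 ≠ 0 →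
        poissonTransform n a f x
          = (((2 * Real.pi) ^ (-((n : ℝ) / 2)) : ℝ) : ℂ) *
              ∫ ξ : (Fin (n - 1) → ℝ) × ℝ,
                Complex.exp (I * (((∑ j, x.1 j * ξ.1 j) + x.2 * ξ.2 : ℝ) : ℂ)) *
                  gFun n a f ξ := by
  haveI : Nonempty (Fin (n - 1)) := ⟨⟨0, by omega⟩⟩
  have hcard : (Fintype.card (Fin (n - 1)) : ℝ) = (n : ℝ) - 1 := by
    rw [Fintype.card_fin, Nat.cast_sub (by omega)]; simp
  obtain ⟨hFi, hFc⟩ := pt_F_nice f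
  have hν : 0 < (1 - a) / 2 := by linarith
  have hσ : (2 - a) / 2 = (1 - a) / 2 + 1 / 2 := by ring
  have hexp : (a - 2) / 2 = -((2 - a) / 2) := by ring
  set K : ℂ := ((Real.sqrt 2 * Real.Gamma ((2 - a) / 2) / Real.Gamma ((1 - a) / 2) : ℝ) : ℂ) with hK
  set c : ℂ := (((2 * Real.pi) ^ (-(((n : ℝ) - 1) / 2)) : ℝ) : ℂ) with hc
  have hg : ∀ ξ, gFun n a f ξ = K * (c * ∫ y : Fin (n - 1) → ℝ,
      Complex.exp (-I * ((∑ j, y j * ξ.1 j : ℝ) : ℂ)) * f y) *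
      (((∑ j, ξ.1 j ^ 2) ^ ((1 - a) / 2) *
        ((∑ j, ξ.1 j ^ 2) + ξ.2 ^ 2) ^ (-((2 - a) / 2)) : ℝ) : ℂ) := fun ξ => by
    rw [gFun, hexp]; rfl
  set F : (Fin (n - 1) → ℝ) → ℂ := fun ξ => ∫ y : Fin (n - 1) → ℝ,
    Complex.exp (-I * ((∑ j, y j * ξ j : ℝ) : ℂ)) * f y with hF
  have hq : ∀ᵐ ξ : Fin (n - 1) → ℝ, 0 < ∑ j, ξ j ^ 2 := by
    have : ∀ᵐ ξ : Fin (n - 1) → ℝ, ξ ≠ 0 := compl_mem_ae_iff.mpr (measure_singleton 0)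
    filter_upwards [this] with ξ hξ
    obtain ⟨j, hj⟩ := Function.ne_iff.mp hξ
    exact Finset.sum_pos' (fun i _ => sq_nonneg _) ⟨j, Finset.mem_univ _, by
      have : ξ j ≠ 0 := hj
      positivity⟩
  have hgm : Measurable (gFun n a f) := by
    have h1 : Measurable F := hFc.measurable
    have h2 : gFun n a f = fun ξ => K * (c * F ξ.1) *
      (((∑ j, ξ.1 j ^ 2) ^ ((1 - a) / 2) *
        ((∑ j, ξ.1 j ^ 2) + ξ.2 ^ 2) ^ (-((2 - a) / 2)) : ℝ) : ℂ) := funext hg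
    rw [h2]; clear_value F; fun_prop
  have hgi : Integrable (gFun n a f) volume := by
    rw [Measure.volume_eq_prod, integrable_prod_iff hgm.aestronglyMeasurable]
    constructor
    · filter_upwards [hq] with ξ hξ
      simp only [hg]
      exact ((((pt_s_int (σ := (2 - a) / 2) (by linarith) hξ).const_mul
        ((∑ j, ξ j ^ 2) ^ ((1 - a) / 2))).ofReal (𝕜 := ℂ)).const_mul (K * (c * F ξ)))
    · have h1 : Integrable (fun ξ => ‖K * (c * F ξ)‖ * ∫ s : ℝ, (1 + s ^ 2) ^ (-((2 - a) / 2))) :=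
        ((hFi.const_mul c).const_mul K).norm.mul_const _
      refine h1.congr ?_
      filter_upwards [hq] with ξ hξ
      rw [← pt_s_norm hσ hξ, ← integral_const_mul]
      congr 1; ext s
      rw [hg, norm_mul (K * _), Complex.norm_real, Real.norm_of_nonneg (by positivity)]
  refine ⟨hgi, fun x hx => ?_⟩
  have hgi2 : Integrable (fun ξ : (Fin (n - 1) → ℝ) × ℝ =>
      Complex.exp (I * (((∑ j, x.1 j * ξ.1 j) + x.2 * ξ.2 : ℝ) : ℂ)) * gFun n a f ξ) volume := by
    refine hgi.mono ?_ (Filter.Eventually.of_forall fun ξ => ?_)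
    · apply Measurable.aestronglyMeasurable
      fun_prop
    · rw [norm_mul, pt_phase, one_mul]
  have hX : 0 < x.2 ^ 2 / 4 := by positivity
  rw [Measure.volume_eq_prod] at hgi2 ⊢
  rw [integral_prod _ hgi2]
  set D : ℂ := ((√Real.pi / Real.Gamma ((2 - a) / 2) * (x.2 ^ 2 / 4) ^ ((1 - a) / 2) : ℝ) : ℂ)
    with hD
  have hinner : ∫ ξ : Fin (n - 1) → ℝ, ∫ s : ℝ,
      Complex.exp (I * (((∑ j, x.1 j * ξ j) + x.2 * s : ℝ) : ℂ)) * gFun n a f (ξ, s)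
      = (K * c * D) * ∫ ξ : Fin (n - 1) → ℝ, Complex.exp (I * ((∑ j, x.1 j * ξ j : ℝ) : ℂ)) * F ξ *
      ((∫ u in Ioi (0:ℝ), u ^ (-((1 - a) / 2) - 1) * Real.exp (-(x.2 ^ 2 / 4 / u)) *
        Real.exp (-(u * ∑ j, ξ j ^ 2)) : ℝ) : ℂ) := by
    rw [← integral_const_mul]
    refine integral_congr_ae ?_
    filter_upwards [hq] with ξ hξ
    have e1 : ∀ s : ℝ, Complex.exp (I * (((∑ j, x.1 j * ξ j) + x.2 * s : ℝ) : ℂ)) *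
        gFun n a f (ξ, s) = (Complex.exp (I * ((∑ j, x.1 j * ξ j : ℝ) : ℂ)) * (K * (c * F ξ))) *
        (Complex.exp (I * ((x.2 * s : ℝ) : ℂ)) * (((∑ j, ξ j ^ 2) ^ ((1 - a) / 2) *
          ((∑ j, ξ j ^ 2) + s ^ 2) ^ (-((2 - a) / 2)) : ℝ) : ℂ)) := fun s => by
      rw [hg, Complex.ofReal_add (∑ j, x.1 j * ξ j), mul_add, Complex.exp_add]; ring
    simp only [e1]
    rw [integral_const_mul, pt_s_fourier hν hσ hξ hx, Complex.ofReal_mul, ← hD]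
    ring
  rw [hinner, pt_core f hν hX x.1, poissonTransform, ← integral_const_mul, ← integral_const_mul,
    ← integral_const_mul, hcard]
  congr 1; ext y
  have hA : 0 < (∑ j, (x.1 j - y j) ^ 2) + x.2 ^ 2 := by
    have : 0 ≤ ∑ j, (x.1 j - y j) ^ 2 := Finset.sum_nonneg fun j _ => sq_nonneg _
    positivity
  have key := pt_const (n := n) ha2 hA hx
  rw [show (1 - a) / 2 + ((n : ℝ) - 1) / 2 = ((n : ℝ) - a) / 2 by ring, ← add_div]
  rw [← mul_assoc, ← Complex.ofReal_mul, key, hK, hc, hD]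
  simp only [← mul_assoc, ← Complex.ofReal_mul]
end

section
/- Let n ≥ 2, 2-n < a < 1, and let f be a Schwartz function on ℝ^{n-1}. Define g : ℝⁿ → ℂ by g(ξ', ξ_n) = (√2 Γ((2−a)/2)/Γ((1−a)/2)) · 𝓕f(ξ') |ξ'|^{1−a} (|ξ'|² + ξ_n²)^{(a−2)/2} (this is the Fourier transform of the Poisson extension P_a f). Then ∫_{ℝⁿ} |g(ξ)|² |ξ|^{2−a} dξ = (2^a π Γ(2−a))/(Γ((1−a)/2) Γ((3−a)/2)) · ∫_{ℝ^{n-1}} |𝓕f(ξ')|² |ξ'|^{1−a} dξ'. Equivalently, the Poisson transform P_a is, up to the explicit constant, an isometry from the homogeneous Sobolev space Ḣ^{(1-a)/2}(ℝ^{n-1}) to Ḣ^{(2-a)/2}(ℝⁿ), where these norms are defined via the weighted Fourier integrals above. -/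
open MeasureTheory
open Complex (I)

lemma lint_gamma (c r : ℝ) (hc : 0 < c) (hr : 0 < r) :
    ∫⁻ u in Set.Ioi (0:ℝ), ENNReal.ofReal (u ^ (c - 1) * Real.exp (-(r * u)))
      = ENNReal.ofReal ((1 / r) ^ c * Real.Gamma c) := by
  have h := Real.integral_rpow_mul_exp_neg_mul_Ioi hc hr
  have hpos : 0 < (1 / r) ^ c * Real.Gamma c :=
    mul_pos (Real.rpow_pos_of_pos (by positivity) _) (Real.Gamma_pos_of_pos hc)
  rw [← h, ofReal_integral_eq_lintegral_ofReal]
  · exact Integrable.of_integral_ne_zero (by rw [h]; exact hpos.ne')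
  · filter_upwards [ae_restrict_mem measurableSet_Ioi] with u hu
    have hu' : (0:ℝ) < u := hu
    simp only [Pi.zero_apply]
    positivity

lemma lint_gauss (u : ℝ) (hu : 0 < u) :
    ∫⁻ t : ℝ, ENNReal.ofReal (Real.exp (-u * t ^ 2)) = ENNReal.ofReal (√(Real.pi / u)) := by
  rw [← integral_gaussian, ofReal_integral_eq_lintegral_ofReal]
  · exact integrable_exp_neg_mul_sq hu
  · exact Filter.Eventually.of_forall fun t => (Real.exp_pos _).le

lemma lint_beta (s b : ℝ) (hs : 0 < s) (hb : 1 / 2 < b) :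
    ∫⁻ t : ℝ, ENNReal.ofReal ((s + t ^ 2) ^ (-b))
      = ENNReal.ofReal (s ^ (1 / 2 - b) * √Real.pi * Real.Gamma (b - 1 / 2) / Real.Gamma b) := by
  have hG : 0 < Real.Gamma b := Real.Gamma_pos_of_pos (by linarith)
  have h1 : ∀ t : ℝ, ENNReal.ofReal ((s + t ^ 2) ^ (-b)) =
      ENNReal.ofReal (1 / Real.Gamma b) *
        ∫⁻ u in Set.Ioi (0:ℝ), ENNReal.ofReal (u ^ (b - 1) * Real.exp (-((s + t ^ 2) * u))) := by
    intro t
    have hst : 0 < s + t ^ 2 := by positivity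
    rw [lint_gamma b _ (by linarith) hst, ← ENNReal.ofReal_mul (by positivity)]
    congr 1
    rw [one_div, one_div, Real.inv_rpow hst.le, Real.rpow_neg hst.le]
    field_simp
  simp_rw [h1]
  rw [lintegral_const_mul' _ _ ENNReal.ofReal_ne_top, lintegral_lintegral_swap]
  · have h2 : ∫⁻ u in Set.Ioi (0:ℝ), ∫⁻ t : ℝ,
          ENNReal.ofReal (u ^ (b - 1) * Real.exp (-((s + t ^ 2) * u)))
        = ∫⁻ u in Set.Ioi (0:ℝ), ENNReal.ofReal (√Real.pi) *
          ENNReal.ofReal (u ^ ((b - 1 / 2) - 1) * Real.exp (-(s * u))) := by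
      apply setLIntegral_congr_fun measurableSet_Ioi
      intro u hu
      have hu' : (0:ℝ) < u := hu
      have h3 : ∀ t : ℝ, ENNReal.ofReal (u ^ (b - 1) * Real.exp (-((s + t ^ 2) * u))) =
          ENNReal.ofReal (u ^ (b - 1) * Real.exp (-(s * u))) *
            ENNReal.ofReal (Real.exp (-u * t ^ 2)) := by
        intro t
        rw [← ENNReal.ofReal_mul (by positivity), mul_assoc, ← Real.exp_add]
        congr 3
        ring
      simp only [h3]
      rw [lintegral_const_mul' _ _ ENNReal.ofReal_ne_top, lint_gauss u hu',
        ← ENNReal.ofReal_mul (by positivity), ← ENNReal.ofReal_mul (by positivity)]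
      congr 1
      rw [Real.sqrt_div Real.pi_pos.le, Real.sqrt_eq_rpow u,
        show b - 1 = (b - 1 / 2 - 1) + 1 / 2 by ring, Real.rpow_add hu']
      field_simp
    rw [h2, lintegral_const_mul' _ _ ENNReal.ofReal_ne_top,
      lint_gamma _ _ (by linarith) hs, ← ENNReal.ofReal_mul (by positivity),
      ← ENNReal.ofReal_mul (by positivity)]
    congr 1
    rw [one_div s, Real.inv_rpow hs.le, ← Real.rpow_neg hs.le,
      show -(b - 1 / 2) = 1 / 2 - b by ring]
    ring
  · apply Measurable.aemeasurable
    fun_prop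

lemma ftb_measurable (n : ℕ) (f : SchwartzMap (Fin (n - 1) → ℝ) ℂ) :
    Measurable (ftb n f) := by
  have hf : Measurable f := f.continuous.measurable
  have : StronglyMeasurable (fun ξ : Fin (n - 1) → ℝ =>
      ∫ y : Fin (n - 1) → ℝ, Complex.exp (-I * ((∑ j, y j * ξ j : ℝ) : ℂ)) * f y) := by
    apply StronglyMeasurable.integral_prod_right'
      (f := fun p : (Fin (n - 1) → ℝ) × (Fin (n - 1) → ℝ) =>
        Complex.exp (-I * ((∑ j, p.2 j * p.1 j : ℝ) : ℂ)) * f p.2)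
    apply Measurable.stronglyMeasurable
    fun_prop
  exact this.measurable.const_mul _

lemma const_eq (a : ℝ) (ha2 : a < 1) :
    (2 : ℝ) ^ a * Real.pi * Real.Gamma (2 - a) /
          (Real.Gamma ((1 - a) / 2) * Real.Gamma ((3 - a) / 2)) =
      (Real.sqrt 2 * Real.Gamma ((2 - a) / 2) / Real.Gamma ((1 - a) / 2)) ^ 2 *
        (√Real.pi * Real.Gamma ((1 - a) / 2) / Real.Gamma ((2 - a) / 2)) := by
  have h := Real.Gamma_mul_Gamma_add_half ((2 - a) / 2)
  rw [show (2 - a) / 2 + 1 / 2 = (3 - a) / 2 by ring, show 2 * ((2 - a) / 2) = 2 - a by ring,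
    show 1 - (2 - a) = a - 1 by ring, Real.rpow_sub_one (by norm_num)] at h
  have g1 : 0 < Real.Gamma ((1 - a) / 2) := Real.Gamma_pos_of_pos (by linarith)
  have g2 : 0 < Real.Gamma ((2 - a) / 2) := Real.Gamma_pos_of_pos (by linarith)
  have g3 : 0 < Real.Gamma ((3 - a) / 2) := Real.Gamma_pos_of_pos (by linarith)
  have hp : √Real.pi * √Real.pi = Real.pi := Real.mul_self_sqrt Real.pi_pos.le
  have h2 : √(2:ℝ) ^ 2 = 2 := Real.sq_sqrt (by norm_num)
  rw [div_pow, mul_pow, h2]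
  rw [div_mul_div_comm, div_eq_div_iff (by positivity) (by positivity)]
  have e : (2:ℝ) ^ a * Real.pi * Real.Gamma (2 - a) =
      2 * √Real.pi * (Real.Gamma ((2 - a) / 2) * Real.Gamma ((3 - a) / 2)) := by
    rw [h]
    linear_combination (-(2:ℝ) ^ a * Real.Gamma (2 - a)) * hp
  rw [e]
  ring

/-- For `2-n < a < 1` and `f` Schwartz on `ℝ^{n-1}`:
`∫ |g(ξ)|² |ξ|^{2−a} dξ = (2^a π Γ(2−a))/(Γ((1−a)/2) Γ((3−a)/2)) ∫ |𝓕f(ξ')|² |ξ'|^{1−a} dξ'`,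
i.e. the Poisson transform is, up to this explicit constant, an isometry from
`Ḣ^{(1-a)/2}(ℝ^{n-1})` to `Ḣ^{(2-a)/2}(ℝⁿ)`. -/
theorem statement10 (n : ℕ) (hn : 2 ≤ n) (a : ℝ) (ha1 : 2 - (n : ℝ) < a) (ha2 : a < 1)
    (f : SchwartzMap (Fin (n - 1) → ℝ) ℂ) :
    ∫ ξ : (Fin (n - 1) → ℝ) × ℝ,
        ‖gFun n a f ξ‖ ^ 2 * ((∑ j, ξ.1 j ^ 2) + ξ.2 ^ 2) ^ ((2 - a) / 2)
      = (2 : ℝ) ^ a * Real.pi * Real.Gamma (2 - a) /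
          (Real.Gamma ((1 - a) / 2) * Real.Gamma ((3 - a) / 2)) *
        ∫ ξ' : Fin (n - 1) → ℝ, ‖ftb n f ξ'‖ ^ 2 * (∑ j, ξ' j ^ 2) ^ ((1 - a) / 2) := by
  have hS : ∀ ξ : Fin (n - 1) → ℝ, 0 ≤ ∑ j, ξ j ^ 2 := fun ξ =>
    Finset.sum_nonneg fun j _ => sq_nonneg _
  have hm := ftb_measurable n f
  have g1 : 0 < Real.Gamma ((1 - a) / 2) := Real.Gamma_pos_of_pos (by linarith)
  have g2 : 0 < Real.Gamma ((2 - a) / 2) := Real.Gamma_pos_of_pos (by linarith)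
  rw [const_eq a ha2, ← integral_const_mul]
  set C := Real.sqrt 2 * Real.Gamma ((2 - a) / 2) / Real.Gamma ((1 - a) / 2) with hC
  set K := √Real.pi * Real.Gamma ((1 - a) / 2) / Real.Gamma ((2 - a) / 2) with hK
  have hK0 : 0 ≤ K := by positivity
  have hgm : Measurable (gFun n a f) := by
    unfold gFun
    fun_prop
  rw [integral_eq_lintegral_of_nonneg_ae, integral_eq_lintegral_of_nonneg_ae]
  rotate_left
  · refine Filter.Eventually.of_forall fun ξ => ?_
    have := hS ξ
    simp only [Pi.zero_apply]
    positivity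
  · apply Measurable.aestronglyMeasurable
    fun_prop
  · refine Filter.Eventually.of_forall fun ξ => ?_
    have := hS ξ.1
    simp only [Pi.zero_apply]
    positivity
  · apply Measurable.aestronglyMeasurable
    fun_prop
  congr 1
  rw [Measure.volume_eq_prod, lintegral_prod]
  swap
  · apply Measurable.aemeasurable
    fun_prop
  apply lintegral_congr
  intro ξ
  have hs := hS ξ
  simp only [gFun]
  rw [← hC]
  generalize (∑ j, ξ j ^ 2) = s at hs ⊢
  rcases hs.eq_or_lt with h0 | hs0
  · subst h0
    have : (1 - a) / 2 ≠ 0 := by linarith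
    simp [Real.zero_rpow this]
  · have h1 : ∀ t : ℝ, ‖(C : ℂ) * ftb n f ξ *
        ((s ^ ((1 - a) / 2) * (s + t ^ 2) ^ ((a - 2) / 2) : ℝ) : ℂ)‖ ^ 2 *
          (s + t ^ 2) ^ ((2 - a) / 2) =
        (C ^ 2 * ‖ftb n f ξ‖ ^ 2 * (s ^ ((1 - a) / 2)) ^ 2) * (s + t ^ 2) ^ (-((2 - a) / 2)) := by
      intro t
      have hst : 0 < s + t ^ 2 := by positivity
      rw [norm_mul, norm_mul, Complex.norm_real, Complex.norm_real, mul_pow, mul_pow,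
        Real.norm_eq_abs, Real.norm_eq_abs, sq_abs, sq_abs,
        show (a - 2) / 2 = -((2 - a) / 2) by ring, Real.rpow_neg hst.le]
      have := Real.rpow_pos_of_pos hst ((2 - a) / 2)
      field_simp
    simp only [h1]
    have hA : 0 ≤ C ^ 2 * ‖ftb n f ξ‖ ^ 2 * (s ^ ((1 - a) / 2)) ^ 2 := by positivity
    simp only [ENNReal.ofReal_mul hA]
    rw [lintegral_const_mul' _ _ ENNReal.ofReal_ne_top, lint_beta s _ hs0 (by linarith),
      ← ENNReal.ofReal_mul hA]
    congr 1
    rw [show (1:ℝ) / 2 - (2 - a) / 2 = -((1 - a) / 2) by ring,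
      show (2 - a) / 2 - 1 / 2 = (1 - a) / 2 by ring, Real.rpow_neg hs0.le, hK]
    have := Real.rpow_pos_of_pos hs0 ((1 - a) / 2)
    field_simp
end

section
/- Let n ≥ 1 be an integer, k ∈ ℕ, and a ∈ ℝ with a < 2n + 4. Let (T_ℓ)_{ℓ ∈ ℕ} be a sequence in a complex vector space and set T_{-1} = 0. Suppose that for all ℓ ∈ ℕ: (ℓ+1)(2(2k+2ℓ+n+2) − a) T_{ℓ+1} − (2(2ℓ+1)(2k+2ℓ+n) + a) T_ℓ + ℓ(2(2k+2ℓ+n−2) + a) T_{ℓ-1} = 0. Then for every ℓ ∈ ℕ, T_ℓ = ((k + n/2 + a/4)_ℓ / (k + n/2 − a/4 + 1)_ℓ) · T_0, where (x)_ℓ = x(x+1)⋯(x+ℓ−1) denotes the Pochhammer symbol. -/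
/-- Let `n ≥ 1`, `k ∈ ℕ`, `a < 2n+4`, and let `(T_ℓ)` be a sequence in a complex vector space
(with the convention `T_{-1} = 0`; note that the coefficient of `T_{ℓ-1}` vanishes for `ℓ = 0`)
satisfying the three-term recurrence
`(ℓ+1)(2(2k+2ℓ+n+2) − a) T_{ℓ+1} − (2(2ℓ+1)(2k+2ℓ+n) + a) T_ℓ
  + ℓ(2(2k+2ℓ+n−2) + a) T_{ℓ-1} = 0`.
Then `T_ℓ = ((k+n/2+a/4)_ℓ / (k+n/2−a/4+1)_ℓ) T_0` for every `ℓ`, where `(x)_ℓ` is the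
Pochhammer symbol (rising factorial). -/
theorem statement19 (n : ℕ) (hn : 1 ≤ n) (k : ℕ) (a : ℝ) (ha : a < 2 * (n : ℝ) + 4)
    (V : Type*) [AddCommGroup V] [Module ℂ V] (T : ℕ → V)
    (hrec : ∀ ℓ : ℕ,
      ((((ℓ : ℂ) + 1) * (2 * (2 * (k : ℂ) + 2 * (ℓ : ℂ) + (n : ℂ) + 2) - (a : ℂ))) • T (ℓ + 1)
        - ((2 * (2 * (ℓ : ℂ) + 1) * (2 * (k : ℂ) + 2 * (ℓ : ℂ) + (n : ℂ)) + (a : ℂ))) • T ℓ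
        + (((ℓ : ℂ)) * (2 * (2 * (k : ℂ) + 2 * (ℓ : ℂ) + (n : ℂ) - 2) + (a : ℂ))) • T (ℓ - 1))
        = 0) :
    ∀ ℓ : ℕ, T ℓ = ((ascPochhammer ℂ ℓ).eval ((k : ℂ) + (n : ℂ) / 2 + (a : ℂ) / 4)
        / (ascPochhammer ℂ ℓ).eval ((k : ℂ) + (n : ℂ) / 2 - (a : ℂ) / 4 + 1)) • T 0 := by
  have hy : ∀ ℓ : ℕ, (k : ℂ) + (n : ℂ) / 2 - (a : ℂ) / 4 + 1 + (ℓ : ℂ) ≠ 0 := by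
    intro ℓ h
    have h2 : (((k : ℝ) + (n : ℝ) / 2 - a / 4 + 1 + (ℓ : ℝ) : ℝ) : ℂ) = 0 := by
      push_cast
      exact h
    have h3 : (k : ℝ) + (n : ℝ) / 2 - a / 4 + 1 + (ℓ : ℝ) = 0 := by exact_mod_cast h2
    have hk : (0 : ℝ) ≤ k := Nat.cast_nonneg k
    have hl : (0 : ℝ) ≤ ℓ := Nat.cast_nonneg ℓ
    linarith
  -- the three-term recurrence says `(ℓ+1) D_ℓ = ℓ D_{ℓ-1}` for the first-order defect `D`
  have hD : ∀ ℓ : ℕ, ((k : ℂ) + (n : ℂ) / 2 - (a : ℂ) / 4 + 1 + (ℓ : ℂ)) • T (ℓ + 1)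
      = ((k : ℂ) + (n : ℂ) / 2 + (a : ℂ) / 4 + (ℓ : ℂ)) • T ℓ := by
    intro ℓ
    induction ℓ with
    | zero =>
      have h := hrec 0
      have h4 : (4 : ℂ) ≠ 0 := by norm_num
      rw [← sub_eq_zero]
      apply (smul_eq_zero_iff_right h4).1
      rw [← h]
      push_cast
      module
    | succ m ih =>
      have h := hrec (m + 1)
      rw [← sub_eq_zero] at ih ⊢
      have h4 : (4 * ((m : ℂ) + 2)) ≠ 0 := by
        have : ((m : ℂ) + 2) ≠ 0 := by exact_mod_cast Nat.succ_ne_zero (m + 1)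
        exact mul_ne_zero (by norm_num) this
      apply (smul_eq_zero_iff_right h4).1
      have e := congrArg (fun v => (4 * ((m : ℂ) + 1)) • v) ih
      simp only [smul_zero] at e
      rw [← add_zero (0 : V)]
      nth_rewrite 1 [← h]
      rw [← e]
      push_cast
      module
  intro ℓ
  induction ℓ with
  | zero => simp
  | succ m ih =>
    have h := hD m
    rw [ih] at h
    have hT : T (m + 1) = ((k : ℂ) + (n : ℂ) / 2 - (a : ℂ) / 4 + 1 + (m : ℂ))⁻¹ •
        (((k : ℂ) + (n : ℂ) / 2 - (a : ℂ) / 4 + 1 + (m : ℂ)) • T (m + 1)) := by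
      rw [smul_smul, inv_mul_cancel₀ (hy m), one_smul]
    rw [hT, h, smul_smul, smul_smul, ascPochhammer_succ_eval, ascPochhammer_succ_eval]
    congr 1
    generalize (k : ℂ) + (n : ℂ) / 2 - (a : ℂ) / 4 + 1 = y
    generalize (k : ℂ) + (n : ℂ) / 2 + (a : ℂ) / 4 = x
    rw [mul_div_mul_comm, div_eq_mul_inv (x + (m : ℂ))]
    ring
end
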